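/- arXiv:1211.0842 — 3 statements merged into one kernel-verified Lean document; each statement's English description precedes it below -/
import Mathlib

section
/- Let K be a field, S = K[x_1,…,x_n], let I ⊆ S be the ideal generated by the variables x_1,…,x_r together with a nonempty set E of squarefree monomials of degree 2 in the variables x_{r+1},…,x_n, and let J ⊂ I be a squarefree monomial ideal generated in degrees ≥ 2 with sdepth_S I/J = 2. Let B be the set of squarefree monomials of degree 2 in I \ J, let x_1x_t ∈ B for some r < t ≤ n, let I' = (x_2,…,x_r) + (B \ {x_1x_t}), J' = J ∩ I', and let 𝒫 be a partition of P_{I'\J'} with sdepth 𝒫 = 3. Assume every squarefree monomial u ∈ S of degree 2 with u ∉ I satisfies x_1·u ∈ J. If c = x_t x_i x_j ∉ J with r < i < j ≤ n and i, j ≠ t, and x_1x_tx_i ∉ J and x_1x_tx_j ∉ J, then b = x_i x_j belongs to B, and if moreover x_1·b ∉ J, then c does not occur in 𝒫 in any interval of the form [a, c] with a ∈ B. -/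
open MvPolynomial

/-- The squarefree monomial with support `T` in `K[x_0,…,x_{n-1}]`. -/
noncomputable def sqf (K : Type*) [Field K] (n : ℕ) (T : Finset (Fin n)) :
    MvPolynomial (Fin n) K :=
  ∏ i ∈ T, X i

/-- The poset `P_{I\J}`: supports of squarefree monomials lying in `I \ J`. -/
def sqfPoset (K : Type*) [Field K] (n : ℕ) (I J : Ideal (MvPolynomial (Fin n) K)) :
    Set (Finset (Fin n)) :=
  {T | sqf K n T ∈ I ∧ sqf K n T ∉ J}

/-- Supports of squarefree monomials of degree `d` lying in `I \ J`. -/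
def degSet (K : Type*) [Field K] (n : ℕ) (I J : Ideal (MvPolynomial (Fin n) K)) (d : ℕ) :
    Set (Finset (Fin n)) :=
  {T | T.card = d ∧ T ∈ sqfPoset K n I J}

/-- A partition of a set `P` of supports of squarefree monomials into intervals
`[u,v] = {w : u ⊆ w ⊆ v}`. -/
structure SqfPartition (n : ℕ) (P : Set (Finset (Fin n))) where
  intervals : Finset (Finset (Fin n) × Finset (Fin n))
  le : ∀ p ∈ intervals, p.1 ⊆ p.2
  ends : ∀ p ∈ intervals, p.1 ∈ P ∧ p.2 ∈ P
  covers : ∀ T ∈ P, ∃ p ∈ intervals, p.1 ⊆ T ∧ T ⊆ p.2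
  disj : ∀ p ∈ intervals, ∀ q ∈ intervals, ∀ T : Finset (Fin n),
    p.1 ⊆ T → T ⊆ p.2 → q.1 ⊆ T → T ⊆ q.2 → p = q

/-- The Stanley depth of a partition: the minimal degree of the upper ends of
its intervals. -/
noncomputable def SqfPartition.sdepth {n : ℕ} {P : Set (Finset (Fin n))}
    (pt : SqfPartition n P) : ℕ :=
  sInf {k | ∃ p ∈ pt.intervals, p.2.card = k}

/-- The Stanley depth of `I/J`: the maximal Stanley depth of a partition of `P_{I\J}`. -/
noncomputable def stanleyDepth (K : Type*) [Field K] (n : ℕ)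
    (I J : Ideal (MvPolynomial (Fin n) K)) : ℕ :=
  sSup {k | ∃ pt : SqfPartition n (sqfPoset K n I J), pt.sdepth = k}

/-- The `S`-module `I/J` (for `J ⊆ I` this is the usual quotient). -/
noncomputable abbrev quotMod (K : Type*) [Field K] (n : ℕ)
    (I J : Ideal (MvPolynomial (Fin n) K)) : Type _ :=
  I ⧸ (Submodule.comap I.subtype J)

/-- The depth of `I/J` over `S = K[x_0,…,x_{n-1}]`: the supremum of lengths of
regular sequences on `I/J` consisting of elements of the maximal graded ideal
`(x_0,…,x_{n-1})`. -/
noncomputable def mdepth (K : Type*) [Field K] (n : ℕ)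
    (I J : Ideal (MvPolynomial (Fin n) K)) : ℕ :=
  sSup {k | ∃ rs : List (MvPolynomial (Fin n) K), rs.length = k ∧
    (∀ r ∈ rs, r ∈ Ideal.span (Set.range (X : Fin n → MvPolynomial (Fin n) K))) ∧
    RingTheory.Sequence.IsRegular (quotMod K n I J) rs}

lemma sqf_dvd_sqf (K : Type*) [Field K] (n : ℕ) {U T : Finset (Fin n)} (h : U ⊆ T) :
    sqf K n U ∣ sqf K n T :=
  Finset.prod_dvd_prod_of_subset _ _ _ h

lemma sqf_mem_of_subset {K : Type*} [Field K] {n : ℕ} {I : Ideal (MvPolynomial (Fin n) K)}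
    {U T : Finset (Fin n)} (h : U ⊆ T) (hU : sqf K n U ∈ I) : sqf K n T ∈ I :=
  I.mem_of_dvd (sqf_dvd_sqf K n h) hU

lemma sqf_mem_span_iff (K : Type*) [Field K] (n : ℕ) (G : Set (Finset (Fin n)))
    (T : Finset (Fin n)) :
    sqf K n T ∈ Ideal.span (sqf K n '' G) ↔ ∃ U ∈ G, U ⊆ T := by
  classical
  constructor
  · intro h
    by_contra! hG
    let φ : MvPolynomial (Fin n) K →+* K := eval fun i => if i ∈ T then 1 else 0
    have hle : Ideal.span (sqf K n '' G) ≤ RingHom.ker φ := by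
      rw [Ideal.span_le]
      rintro _ ⟨U, hU, rfl⟩
      obtain ⟨k, hkU, hkT⟩ := Finset.not_subset.1 (hG U hU)
      simp only [SetLike.mem_coe, RingHom.mem_ker, φ, sqf, map_prod, eval_X]
      exact Finset.prod_eq_zero hkU (by simp [hkT])
    have h0 : φ (sqf K n T) = 0 := hle h
    have h1 : φ (sqf K n T) = 1 := by
      simp only [φ, sqf, map_prod, eval_X]
      exact Finset.prod_eq_one fun i hi => by simp [hi]
    exact one_ne_zero (h1.symm.trans h0)
  · rintro ⟨U, hU, hUT⟩
    exact sqf_mem_of_subset hUT (Ideal.subset_span ⟨U, hU, rfl⟩)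

lemma sqf_mem_span_X_union_iff (K : Type*) [Field K] (n : ℕ) (A : Set (Fin n))
    (G : Set (Finset (Fin n))) (T : Finset (Fin n)) :
    sqf K n T ∈ Ideal.span ((X '' A) ∪ sqf K n '' G) ↔
      (∃ k ∈ A, k ∈ T) ∨ ∃ U ∈ G, U ⊆ T := by
  have hX : (X '' A : Set (MvPolynomial (Fin n) K)) = sqf K n '' ((fun k => {k}) '' A) := by
    rw [Set.image_image]
    simp [sqf]
  rw [hX, ← Set.image_union, sqf_mem_span_iff]
  simp only [Set.mem_union, or_and_right, exists_or, Set.exists_mem_image,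
    Finset.singleton_subset_iff]

lemma sqfPoset_ordConnected (K : Type*) [Field K] (n : ℕ)
    (I J : Ideal (MvPolynomial (Fin n) K)) : (sqfPoset K n I J).OrdConnected :=
  ⟨fun _ hU _ hV _ hT => ⟨sqf_mem_of_subset hT.1 hU.1, fun h => hV.2 (sqf_mem_of_subset hT.2 h)⟩⟩

lemma SqfPartition.sdepth_le_card {n : ℕ} {P : Set (Finset (Fin n))} (pt : SqfPartition n P)
    {p : Finset (Fin n) × Finset (Fin n)} (hp : p ∈ pt.intervals) : pt.sdepth ≤ p.2.card :=
  Nat.sInf_le ⟨p, hp, rfl⟩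

lemma SqfPartition.sdepth_le {n : ℕ} {P : Set (Finset (Fin n))} (pt : SqfPartition n P) :
    pt.sdepth ≤ n := by
  rcases pt.intervals.eq_empty_or_nonempty with h | ⟨p, hp⟩
  · simp [SqfPartition.sdepth, h]
  · exact (pt.sdepth_le_card hp).trans (by simpa using p.2.card_le_univ)

lemma le_stanleyDepth {K : Type*} [Field K] {n : ℕ} {I J : Ideal (MvPolynomial (Fin n) K)}
    (hne : (sqfPoset K n I J).Nonempty) (pt : SqfPartition n (sqfPoset K n I J)) {d : ℕ}
    (hd : ∀ p ∈ pt.intervals, d ≤ p.2.card) : d ≤ stanleyDepth K n I J := by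
  have hle : d ≤ pt.sdepth := by
    obtain ⟨T, hT⟩ := hne
    obtain ⟨p, hp, -⟩ := pt.covers T hT
    refine le_csInf ⟨_, p, hp, rfl⟩ ?_
    rintro _ ⟨q, hq, rfl⟩
    exact hd q hq
  refine hle.trans (le_csSup ⟨n, ?_⟩ ⟨pt, rfl⟩)
  rintro _ ⟨q, rfl⟩
  exact q.sdepth_le

/-- Disjoint intervals covering everything of degree `< d` extend to a partition by singletons. -/
lemma exists_partition_of_disjoint_intervals {n d : ℕ} {P : Set (Finset (Fin n))}
    (F : Finset (Finset (Fin n) × Finset (Fin n)))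
    (hle : ∀ p ∈ F, p.1 ⊆ p.2) (hends : ∀ p ∈ F, p.1 ∈ P ∧ p.2 ∈ P)
    (hdisj : ∀ p ∈ F, ∀ q ∈ F, ∀ T : Finset (Fin n),
      p.1 ⊆ T → T ⊆ p.2 → q.1 ⊆ T → T ⊆ q.2 → p = q)
    (hd : ∀ p ∈ F, d ≤ p.2.card)
    (hcov : ∀ T ∈ P, T.card < d → ∃ p ∈ F, p.1 ⊆ T ∧ T ⊆ p.2) :
    ∃ pt : SqfPartition n P, ∀ p ∈ pt.intervals, d ≤ p.2.card := by
  classical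
  let M : Finset (Finset (Fin n)) :=
    Finset.univ.filter fun T => T ∈ P ∧ ∀ p ∈ F, ¬ (p.1 ⊆ T ∧ T ⊆ p.2)
  have hM : ∀ p, p ∈ F ∪ M.image (fun T => (T, T)) ↔
      p ∈ F ∨ ∃ T, (T ∈ P ∧ ∀ q ∈ F, ¬ (q.1 ⊆ T ∧ T ⊆ q.2)) ∧ (T, T) = p := by
    simp [M]
  refine ⟨⟨F ∪ M.image (fun T => (T, T)), ?_, ?_, ?_, ?_⟩, ?_⟩
  · intro p hp
    rcases (hM p).1 hp with hp | ⟨T, -, rfl⟩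
    exacts [hle p hp, subset_rfl]
  · intro p hp
    rcases (hM p).1 hp with hp | ⟨T, hT, rfl⟩
    exacts [hends p hp, ⟨hT.1, hT.1⟩]
  · intro T hT
    by_cases h : ∃ p ∈ F, p.1 ⊆ T ∧ T ⊆ p.2
    · obtain ⟨p, hp, h⟩ := h
      exact ⟨p, (hM p).2 (Or.inl hp), h⟩
    · push Not at h
      exact ⟨(T, T), (hM _).2 (Or.inr ⟨T, ⟨hT, fun p hp hpT => h p hp hpT.1 hpT.2⟩, rfl⟩),
        subset_rfl, subset_rfl⟩
  · intro p hp q hq T h1 h2 h3 h4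
    rcases (hM p).1 hp with hp | ⟨U, hU, rfl⟩ <;> rcases (hM q).1 hq with hq | ⟨V, hV, rfl⟩
    · exact hdisj p hp q hq T h1 h2 h3 h4
    · obtain rfl := h4.antisymm h3
      exact absurd ⟨h1, h2⟩ (hV.2 p hp)
    · obtain rfl := h2.antisymm h1
      exact absurd ⟨h3, h4⟩ (hU.2 q hq)
    · obtain rfl := h2.antisymm h1
      obtain rfl := h4.antisymm h3
      rfl
  · intro p hp
    rcases (hM p).1 hp with hp | ⟨T, ⟨hTP, hT⟩, rfl⟩
    · exact hd p hp
    · by_contra! hlt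
      obtain ⟨p, hp, h⟩ := hcov T hTP hlt
      exact hT p hp h

/-- Replacing the intervals of a partition of `Q` whose lower ends lie in `R` by those in `N`. -/
lemma exists_partition_of_exchange {n : ℕ} {P Q : Set (Finset (Fin n))} (hQP : Q ⊆ P)
    (pt : SqfPartition n Q) (h3 : ∀ p ∈ pt.intervals, 3 ≤ p.2.card)
    (R : Set (Finset (Fin n))) (hR : ∀ T ∈ R, T.card = 2)
    (N : Finset (Finset (Fin n) × Finset (Fin n)))
    (hle : ∀ p ∈ N, p.1 ⊆ p.2) (hends : ∀ p ∈ N, p.1 ∈ P ∧ p.2 ∈ P)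
    (hdisj : ∀ p ∈ N, ∀ q ∈ N, ∀ T : Finset (Fin n),
      p.1 ⊆ T → T ⊆ p.2 → q.1 ⊆ T → T ⊆ q.2 → p = q)
    (hN3 : ∀ p ∈ N, 3 ≤ p.2.card)
    (hNR : ∀ q ∈ N, ∀ T : Finset (Fin n), q.1 ⊆ T → T ⊆ q.2 →
      ∀ p ∈ pt.intervals, p.1 ⊆ T → T ⊆ p.2 → p.1 ∈ R ∨ 3 ≤ p.1.card)
    (hcovR : ∀ T ∈ R, ∃ q ∈ N, q.1 ⊆ T ∧ T ⊆ q.2)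
    (hcov : ∀ T ∈ P, T ∉ Q → T.card ≤ 2 → ∃ q ∈ N, q.1 ⊆ T ∧ T ⊆ q.2) :
    ∃ pt : SqfPartition n P, ∀ p ∈ pt.intervals, 3 ≤ p.2.card := by
  classical
  have hF : ∀ p, p ∈ N ∪ pt.intervals.filter (fun p => p.1 ∉ R ∧ p.1.card ≤ 2) ↔
      p ∈ N ∨ (p ∈ pt.intervals ∧ p.1 ∉ R ∧ p.1.card ≤ 2) := by simp
  have hsep : ∀ q ∈ N, ∀ p ∈ pt.intervals, p.1 ∉ R → p.1.card ≤ 2 → ∀ T : Finset (Fin n),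
      q.1 ⊆ T → T ⊆ q.2 → p.1 ⊆ T → T ⊆ p.2 → False := by
    intro q hq p hp hpR hp2 T h1 h2 h3 h4
    rcases hNR q hq T h1 h2 p hp h3 h4 with h | h
    · exact hpR h
    · omega
  refine exists_partition_of_disjoint_intervals
    (N ∪ pt.intervals.filter (fun p => p.1 ∉ R ∧ p.1.card ≤ 2)) ?_ ?_ ?_ ?_ ?_
  · intro p hp
    rcases (hF p).1 hp with hp | ⟨hp, -⟩
    exacts [hle p hp, pt.le p hp]
  · intro p hp
    rcases (hF p).1 hp with hp | ⟨hp, -⟩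
    exacts [hends p hp, ⟨hQP (pt.ends p hp).1, hQP (pt.ends p hp).2⟩]
  · intro p hp q hq T h1 h2 h3 h4
    rcases (hF p).1 hp with hp | ⟨hp, hpR, hp2⟩ <;>
      rcases (hF q).1 hq with hq | ⟨hq, hqR, hq2⟩
    · exact hdisj p hp q hq T h1 h2 h3 h4
    · exact (hsep p hp q hq hqR hq2 T h1 h2 h3 h4).elim
    · exact (hsep q hq p hp hpR hp2 T h3 h4 h1 h2).elim
    · exact pt.disj p hp q hq T h1 h2 h3 h4
  · intro p hp
    rcases (hF p).1 hp with hp | ⟨hp, -⟩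
    exacts [hN3 p hp, h3 p hp]
  · intro T hT hT2
    by_cases hTQ : T ∈ Q
    · obtain ⟨p, hp, hpT, hTp⟩ := pt.covers T hTQ
      have hc := Finset.card_le_card hpT
      by_cases hpR : p.1 ∈ R
      · obtain rfl : p.1 = T := Finset.eq_of_subset_of_card_le hpT (by have := hR _ hpR; omega)
        obtain ⟨q, hq, h⟩ := hcovR _ hpR
        exact ⟨q, (hF q).2 (Or.inl hq), h⟩
      · exact ⟨p, (hF p).2 (Or.inr ⟨hp, hpR, by omega⟩), hpT, hTp⟩
    · obtain ⟨q, hq, h⟩ := hcov T hT hTQ (by omega)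
      exact ⟨q, (hF q).2 (Or.inl hq), h⟩

lemma eq_pair_of_subset_triple {α : Type*} [DecidableEq α] {a b c : α} {T : Finset α}
    (hT : T ⊆ {a, b, c}) (h2 : 2 ≤ T.card) :
    T = {a, b} ∨ T = {a, c} ∨ T = {b, c} ∨ 3 ≤ T.card := by
  by_cases h3 : 3 ≤ T.card
  · simp [h3]
  obtain ⟨x, y, hxy, rfl⟩ := Finset.card_eq_two.1 (show T.card = 2 by omega)
  have hx := hT (Finset.mem_insert_self x {y})
  have hy := hT (show y ∈ ({x, y} : Finset α) by simp)
  simp only [Finset.mem_insert, Finset.mem_singleton] at hx hy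
  rcases hx with rfl | rfl | rfl <;> rcases hy with rfl | rfl | rfl <;>
    simp_all [Finset.pair_comm]

section Exchange

variable {n : ℕ} {P Q : Set (Finset (Fin n))} {z t i j : Fin n}

/-- If `x_z x_t x_i` is not covered from `x_t x_i`, the interval `[x_z, x_z x_t x_i]` fits. -/
lemma exists_interval_of_not_exists_partition (hQP : Q ⊆ P)
    (pt : SqfPartition n Q) (h3 : ∀ p ∈ pt.intervals, 3 ≤ p.2.card)
    (hno : ¬ ∃ q : SqfPartition n P, ∀ p ∈ q.intervals, 3 ≤ p.2.card)
    (hz : {z} ∈ P) (hztQ : {z, t} ∉ Q)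
    (hext : ∀ T ∈ P, T ∉ Q → T.card ≤ 2 → {z} ⊆ T ∧ T ⊆ {z, t})
    (hzt : z ≠ t) (hzi : z ≠ i) (hti : t ≠ i)
    (hbot : ∀ T ∈ Q, T ⊆ {z, t, i} → 2 ≤ T.card) (hzti : {z, t, i} ∈ P) :
    ∃ p ∈ pt.intervals, p.1 = {t, i} ∧ {z, t, i} ⊆ p.2 := by
  by_contra! hcon
  refine hno (exists_partition_of_exchange hQP pt h3 {{z, i}} ?_ {({z}, {z, t, i})}
    ?_ ?_ ?_ ?_ ?_ ?_ ?_)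
  · simp [Finset.card_pair hzi]
  · simp
  · simpa using ⟨hz, hzti⟩
  · simp
  · simp [Finset.card_eq_three.2 ⟨z, t, i, hzt, hzi, hti, rfl⟩]
  · simp only [Finset.mem_singleton, forall_eq, Set.mem_singleton_iff]
    intro T hT1 hT2 p hp hpT hTp
    have hpQ := (pt.ends p hp).1
    rcases eq_pair_of_subset_triple (hpT.trans hT2) (hbot _ hpQ (hpT.trans hT2))
      with h | h | h | h
    · exact absurd (h ▸ hpQ) hztQ
    · exact Or.inl h
    · refine absurd ((Finset.insert_subset_iff.2 ⟨?_, ?_⟩).trans hTp) (hcon p hp h)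
      · simpa using hT1
      · rwa [← h]
    · exact Or.inr h
  · simp only [Set.mem_singleton_iff, Finset.mem_singleton, exists_eq_left, forall_eq]
    grind
  · intro T hT hTQ hT2
    obtain ⟨h1, h2⟩ := hext T hT hTQ hT2
    exact ⟨_, Finset.mem_singleton_self _, h1, h2.trans (by grind)⟩

/-- `x_t x_i x_j` is covered from `x_t x_j` or `x_i x_j`, since otherwise the intervals
`[x_z, x_z x_t x_i]` and `[x_t x_i, x_t x_i x_j]` fit. -/
lemma exists_cover_of_not_exists_partition (hQP : Q ⊆ P)
    (pt : SqfPartition n Q) (h3 : ∀ p ∈ pt.intervals, 3 ≤ p.2.card)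
    (hno : ¬ ∃ q : SqfPartition n P, ∀ p ∈ q.intervals, 3 ≤ p.2.card)
    (hz : {z} ∈ P) (hztQ : {z, t} ∉ Q)
    (hext : ∀ T ∈ P, T ∉ Q → T.card ≤ 2 → {z} ⊆ T ∧ T ⊆ {z, t})
    (hzt : z ≠ t) (hzi : z ≠ i) (hzj : z ≠ j) (hti : t ≠ i) (htj : t ≠ j) (hij : i ≠ j)
    (hbot : ∀ T ∈ Q, T ⊆ {z, t, i, j} → 2 ≤ T.card) (hzti : {z, t, i} ∈ P)
    (hti_mem : {t, i} ∈ P) (htij : {t, i, j} ∈ P) :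
    ∃ p ∈ pt.intervals, (p.1 = {t, j} ∨ p.1 = {i, j}) ∧ {t, i, j} ⊆ p.2 := by
  by_contra! hcon
  refine hno (exists_partition_of_exchange hQP pt h3 {{z, i}, {t, i}} ?_
    {({z}, {z, t, i}), ({t, i}, {t, i, j})} ?_ ?_ ?_ ?_ ?_ ?_ ?_)
  · simp [hzi, hti]
  · simp only [Finset.mem_insert, Finset.mem_singleton, forall_eq_or_imp, forall_eq]
    grind
  · simp only [Finset.mem_insert, Finset.mem_singleton, forall_eq_or_imp, forall_eq]
    exact ⟨⟨hz, hzti⟩, hti_mem, htij⟩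
  · simp only [Finset.mem_insert, Finset.mem_singleton, forall_eq_or_imp, forall_eq]
    grind
  · simp [Finset.card_eq_three.2 ⟨z, t, i, hzt, hzi, hti, rfl⟩,
      Finset.card_eq_three.2 ⟨t, i, j, hti, htj, hij, rfl⟩]
  · simp only [Finset.mem_insert, Finset.mem_singleton, forall_eq_or_imp, forall_eq,
      Set.mem_insert_iff, Set.mem_singleton_iff]
    refine ⟨fun T hT1 hT2 p hp hpT hTp => ?_, fun T hT1 hT2 p hp hpT hTp => ?_⟩ <;>
      have hpQ := (pt.ends p hp).1
    · rcases eq_pair_of_subset_triple (hpT.trans hT2)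
        (hbot _ hpQ ((hpT.trans hT2).trans (by grind))) with h | h | h | h
      · exact absurd (h ▸ hpQ) hztQ
      all_goals simp [h]
    · rcases eq_pair_of_subset_triple (hpT.trans hT2)
        (hbot _ hpQ ((hpT.trans hT2).trans (by grind))) with h | h | h | h
      · simp [h]
      · exact absurd (by grind) (hcon p hp (Or.inl h))
      · exact absurd (by grind) (hcon p hp (Or.inr h))
      · simp [h]
  · simp only [Set.mem_insert_iff, Set.mem_singleton_iff, Finset.mem_insert,
      Finset.mem_singleton, exists_eq_or_imp, exists_eq_left, forall_eq_or_imp, forall_eq]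
    grind
  · intro T hT hTQ hT2
    obtain ⟨h1, h2⟩ := hext T hT hTQ hT2
    exact ⟨_, Finset.mem_insert_self _ _, h1, h2.trans (by grind)⟩

/-- If `[x_i x_j, x_t x_i x_j]` is an interval, then `x_z x_i x_j` is covered from `x_z x_j`,
since otherwise `[x_z, x_z x_t x_i]`, `[x_t x_i, x_t x_i x_j]` and `[x_i x_j, x_z x_i x_j]` fit. -/
lemma exists_cover_of_interval_mem (hQP : Q ⊆ P)
    (pt : SqfPartition n Q) (h3 : ∀ p ∈ pt.intervals, 3 ≤ p.2.card)
    (hno : ¬ ∃ q : SqfPartition n P, ∀ p ∈ q.intervals, 3 ≤ p.2.card)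
    (hz : {z} ∈ P) (hztQ : {z, t} ∉ Q)
    (hext : ∀ T ∈ P, T ∉ Q → T.card ≤ 2 → {z} ⊆ T ∧ T ⊆ {z, t})
    (hzt : z ≠ t) (hzi : z ≠ i) (hzj : z ≠ j) (hti : t ≠ i) (htj : t ≠ j) (hij : i ≠ j)
    (hbot : ∀ T ∈ Q, T ⊆ {z, t, i, j} → 2 ≤ T.card) (hzti : {z, t, i} ∈ P)
    (hti_mem : {t, i} ∈ P) (hzij : {z, i, j} ∈ P)
    (hmem : (({i, j}, {t, i, j}) : Finset (Fin n) × Finset (Fin n)) ∈ pt.intervals) :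
    ∃ p ∈ pt.intervals, p.1 = {z, j} ∧ {z, i, j} ⊆ p.2 := by
  by_contra! hcon
  have hb : {i, j} ∈ P ∧ {t, i, j} ∈ P :=
    ⟨hQP (pt.ends _ hmem).1, hQP (pt.ends _ hmem).2⟩
  refine hno (exists_partition_of_exchange hQP pt h3 {{z, i}, {t, i}, {i, j}} ?_
    {({z}, {z, t, i}), ({t, i}, {t, i, j}), ({i, j}, {z, i, j})} ?_ ?_ ?_ ?_ ?_ ?_ ?_)
  · simp [hzi, hti, hij]
  · simp only [Finset.mem_insert, Finset.mem_singleton, forall_eq_or_imp, forall_eq]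
    grind
  · simp only [Finset.mem_insert, Finset.mem_singleton, forall_eq_or_imp, forall_eq]
    exact ⟨⟨hz, hzti⟩, ⟨hti_mem, hb.2⟩, hb.1, hzij⟩
  · clear * - hzt hzi hzj hti htj hij
    intro p hp q hq T
    simp only [Finset.mem_insert, Finset.mem_singleton] at hp hq
    rcases hp with rfl | rfl | rfl <;> rcases hq with rfl | rfl | rfl <;>
      simp only [Finset.insert_subset_iff, Finset.singleton_subset_iff] <;> grind
  · simp [Finset.card_eq_three.2 ⟨z, t, i, hzt, hzi, hti, rfl⟩,
      Finset.card_eq_three.2 ⟨t, i, j, hti, htj, hij, rfl⟩,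
      Finset.card_eq_three.2 ⟨z, i, j, hzi, hzj, hij, rfl⟩]
  · simp only [Finset.mem_insert, Finset.mem_singleton, forall_eq_or_imp, forall_eq,
      Set.mem_insert_iff, Set.mem_singleton_iff]
    refine ⟨fun T hT1 hT2 p hp hpT hTp => ?_, fun T hT1 hT2 p hp hpT hTp => ?_,
      fun T hT1 hT2 p hp hpT hTp => ?_⟩ <;>
      have hpQ := (pt.ends p hp).1
    · rcases eq_pair_of_subset_triple (hpT.trans hT2)
        (hbot _ hpQ ((hpT.trans hT2).trans (by grind))) with h | h | h | h
      · exact absurd (h ▸ hpQ) hztQ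
      all_goals simp [h]
    · rcases eq_pair_of_subset_triple (hpT.trans hT2)
        (hbot _ hpQ ((hpT.trans hT2).trans (by grind))) with h | h | h | h
      · simp [h]
      · have hc : {t, i, j} ⊆ p.2 := by grind
        have := pt.disj p hp _ hmem {t, i, j} (by grind) hc (by grind) subset_rfl
        simp [this]
      all_goals simp [h]
    · rcases eq_pair_of_subset_triple (hpT.trans hT2)
        (hbot _ hpQ ((hpT.trans hT2).trans (by grind))) with h | h | h | h
      · simp [h]
      · exact absurd (by grind) (hcon p hp h)
      all_goals simp [h]
  · simp only [Set.mem_insert_iff, Set.mem_singleton_iff, Finset.mem_insert,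
      Finset.mem_singleton, exists_eq_or_imp, exists_eq_left, forall_eq_or_imp, forall_eq]
    grind
  · intro T hT hTQ hT2
    obtain ⟨h1, h2⟩ := hext T hT hTQ hT2
    exact ⟨_, Finset.mem_insert_self _ _, h1, h2.trans (by grind)⟩

end Exchange


/-- **Lemma 1.7 (2).** -/
theorem stmt4 (n : ℕ) [NeZero n] (K : Type*) [Field K]
    (r : ℕ) (hr1 : 1 ≤ r) (hrn : r ≤ n)
    (I J : Ideal (MvPolynomial (Fin n) K))
    (E : Set (Finset (Fin n))) (hE : E.Nonempty)
    (hEdeg : ∀ T ∈ E, T.card = 2 ∧ ∀ i ∈ T, r ≤ (i : ℕ))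
    (hI : I = Ideal.span ((X '' {i : Fin n | (i : ℕ) < r}) ∪ sqf K n '' E))
    (hJI : J < I)
    (hJ : ∃ G : Set (Finset (Fin n)), (∀ T ∈ G, 2 ≤ T.card) ∧
      J = Ideal.span (sqf K n '' G))
    (hsd : stanleyDepth K n I J = 2)
    (t : Fin n) (ht : r ≤ (t : ℕ))
    (hxt : ({0, t} : Finset (Fin n)) ∈ degSet K n I J 2)
    (I' J' : Ideal (MvPolynomial (Fin n) K))
    (hI' : I' = Ideal.span ((X '' {i : Fin n | 0 < (i : ℕ) ∧ (i : ℕ) < r}) ∪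
      sqf K n '' (degSet K n I J 2 \ {({0, t} : Finset (Fin n))})))
    (hJ' : J' = J ⊓ I')
    (pt : SqfPartition n (sqfPoset K n I' J'))
    (hpt : pt.sdepth = 3)
    (hout : ∀ T : Finset (Fin n), T.card = 2 → sqf K n T ∉ I →
      X (0 : Fin n) * sqf K n T ∈ J) :
    ∀ i j : Fin n, r ≤ (i : ℕ) → (i : ℕ) < (j : ℕ) → i ≠ t → j ≠ t →
      sqf K n {t, i, j} ∉ J →
      X (0 : Fin n) * X t * X i ∉ J → X (0 : Fin n) * X t * X j ∉ J →
      ({i, j} : Finset (Fin n)) ∈ degSet K n I J 2 ∧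
        (X (0 : Fin n) * sqf K n {i, j} ∉ J →
          ∀ a ∈ degSet K n I J 2,
            (a, ({t, i, j} : Finset (Fin n))) ∉ pt.intervals) := by
  intro i j hi hlt hit hjt hcJ hi3 hj3
  have hj : r ≤ (j : ℕ) := by omega
  have h0t : (0 : Fin n) ≠ t := by rintro rfl; simp at ht; omega
  have h0i : (0 : Fin n) ≠ i := by rintro rfl; simp at hi; omega
  have h0j : (0 : Fin n) ≠ j := by rintro rfl; simp at hj; omega
  have hij : i ≠ j := by rintro rfl; omega
  have hmemI : ∀ T, sqf K n T ∈ I ↔ (∃ k : Fin n, (k : ℕ) < r ∧ k ∈ T) ∨ ∃ U ∈ E, U ⊆ T :=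
    fun T => by rw [hI, sqf_mem_span_X_union_iff]; rfl
  have hmemI' : ∀ T, sqf K n T ∈ I' ↔ (∃ k : Fin n, (0 < (k : ℕ) ∧ (k : ℕ) < r) ∧ k ∈ T) ∨
      ∃ U ∈ degSet K n I J 2 \ {({0, t} : Finset (Fin n))}, U ⊆ T :=
    fun T => by rw [hI', sqf_mem_span_X_union_iff]; rfl
  have h0I : ∀ T : Finset (Fin n), 0 ∈ T → sqf K n T ∈ I :=
    fun T hT => (hmemI T).2 (Or.inl ⟨0, by simpa using Nat.pos_of_ne_zero (by omega), hT⟩)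
  have hJmono : ∀ {U T : Finset (Fin n)}, U ⊆ T → sqf K n T ∉ J → sqf K n U ∉ J :=
    fun h hT hU => hT (sqf_mem_of_subset h hU)
  have hII' : ∀ T, sqf K n T ∈ I' → sqf K n T ∈ I := by
    intro T hT
    rcases (hmemI' T).1 hT with ⟨k, hk, hkT⟩ | ⟨U, hU, hUT⟩
    · exact (hmemI T).2 (Or.inl ⟨k, hk.2, hkT⟩)
    · exact sqf_mem_of_subset hUT hU.1.2.1
  have hX3 : ∀ k : Fin n, 0 ≠ k → k ≠ t → X (0 : Fin n) * X t * X k = sqf K n {0, t, k} := by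
    intro k h0k hkt
    rw [sqf, Finset.prod_insert (by simp [h0t, h0k]), Finset.prod_pair hkt.symm, mul_assoc]
  have hX2 : X (0 : Fin n) * sqf K n {i, j} = sqf K n {0, i, j} :=
    (Finset.prod_insert (by simp [h0i, h0j])).symm
  rw [hX3 i h0i hit] at hi3
  rw [hX3 j h0j hjt] at hj3
  have hQ : ∀ T, T ∈ sqfPoset K n I' J' ↔ sqf K n T ∈ I' ∧ sqf K n T ∉ J := by
    intro T
    simp only [sqfPoset, hJ', Set.mem_ofPred_eq, Ideal.mem_inf]
    tauto
  have hQP : sqfPoset K n I' J' ⊆ sqfPoset K n I J :=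
    fun T hT => ⟨hII' T ((hQ T).1 hT).1, ((hQ T).1 hT).2⟩
  have h3 : ∀ p ∈ pt.intervals, 3 ≤ p.2.card := fun p hp => hpt ▸ pt.sdepth_le_card hp
  have hno : ¬ ∃ q : SqfPartition n (sqfPoset K n I J), ∀ p ∈ q.intervals, 3 ≤ p.2.card := by
    rintro ⟨q, hq⟩
    have := le_stanleyDepth ⟨_, hxt.2⟩ q hq
    omega
  have hz : {0} ∈ sqfPoset K n I J := ⟨h0I _ (by simp), hJmono (by simp) hxt.2.2⟩
  have hbot : ∀ T ∈ sqfPoset K n I' J', (∀ k ∈ T, k = 0 ∨ r ≤ (k : ℕ)) →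
      ∃ U ∈ degSet K n I J 2 \ {({0, t} : Finset (Fin n))}, U ⊆ T := by
    intro T hT hk
    refine ((hmemI' T).1 ((hQ T).1 hT).1).resolve_left ?_
    rintro ⟨k, ⟨hk0, hkr⟩, hkT⟩
    rcases hk k hkT with rfl | h
    · simp at hk0
    · omega
  have hbot2 : ∀ T ∈ sqfPoset K n I' J', T ⊆ {0, t, i, j} → 2 ≤ T.card := by
    intro T hT hT4
    obtain ⟨U, hU, hUT⟩ := hbot T hT fun k hk => by
      have := hT4 hk
      simp only [Finset.mem_insert, Finset.mem_singleton] at this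
      rcases this with rfl | rfl | rfl | rfl <;> simp [*]
    exact hU.1.1 ▸ Finset.card_le_card hUT
  have hztQ : ({0, t} : Finset (Fin n)) ∉ sqfPoset K n I' J' := by
    intro h
    obtain ⟨U, hU, hUT⟩ := hbot _ h (by simp [ht])
    exact hU.2 (Finset.eq_of_subset_of_card_le hUT (by rw [hU.1.1, hxt.1]))
  have hext : ∀ T ∈ sqfPoset K n I J, T ∉ sqfPoset K n I' J' → T.card ≤ 2 →
      {0} ⊆ T ∧ T ⊆ {0, t} := by
    intro T hT hTQ hT2
    have hTI' : sqf K n T ∉ I' := fun h => hTQ ((hQ T).2 ⟨h, hT.2⟩)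
    have h2 : T.card = 2 → T = {0, t} := by
      intro hc
      by_contra hne
      exact hTI' ((hmemI' T).2 (Or.inr ⟨T, ⟨⟨hc, hT⟩, hne⟩, subset_rfl⟩))
    rcases (hmemI T).1 hT.1 with ⟨k, hkr, hkT⟩ | ⟨U, hU, hUT⟩
    · obtain rfl : k = 0 := by
        by_contra hk
        exact hTI' ((hmemI' T).2 (Or.inl ⟨k, ⟨Fin.pos_iff_ne_zero.2 hk, hkr⟩, hkT⟩))
      refine ⟨by simpa using hkT, ?_⟩
      by_cases hc : T.card = 2
      · exact (h2 hc).subset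
      · have := Finset.card_le_one.1 (show T.card ≤ 1 by omega)
        exact fun x hx => by simp [this x hx 0 hkT]
    · have := (hEdeg U hU).1
      have := Finset.card_le_card hUT
      have hTt := h2 (by omega)
      simp [hTt]
  have hA : ∀ k : Fin n, 0 ≠ k → k ≠ t → k ∈ ({i, j} : Finset (Fin n)) →
      sqf K n {0, t, k} ∉ J →
      ∃ p ∈ pt.intervals, p.1 = {t, k} ∧ {0, t, k} ⊆ p.2 := fun k h0k hkt hk hkJ =>
    exists_interval_of_not_exists_partition hQP pt h3 hno hz hztQ hext h0t h0k hkt.symm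
      (fun T hT hTk => hbot2 T hT (hTk.trans (by grind))) ⟨h0I _ (by simp), hkJ⟩
  obtain ⟨p, hp, hp1, hp2⟩ := hA i h0i hit (by simp) hi3
  obtain ⟨q, hq, hq1, hq2⟩ := hA j h0j hjt (by simp) hj3
  have htiP : {t, i} ∈ sqfPoset K n I J := hQP (hp1 ▸ (pt.ends p hp).1)
  have htjP : {t, j} ∈ sqfPoset K n I J := hQP (hq1 ▸ (pt.ends q hq).1)
  have hcP : {t, i, j} ∈ sqfPoset K n I J := ⟨sqf_mem_of_subset (by grind) htiP.1, hcJ⟩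
  refine ⟨⟨Finset.card_pair hij, ?_, hJmono (by grind) hcJ⟩, ?_⟩
  · by_contra hbI
    have hbJ := hout _ (Finset.card_pair hij) hbI
    rw [hX2] at hbJ
    obtain ⟨u, hu, hu1, hu2⟩ := exists_cover_of_not_exists_partition hQP pt h3 hno hz hztQ hext
      h0t h0i h0j hit.symm hjt.symm hij hbot2 ⟨h0I _ (by simp), hi3⟩ htiP hcP
    rcases hu1 with hu1 | hu1
    · obtain rfl : u = q := pt.disj u hu q hq {t, j} hu1.subset (by grind) hq1.subset (by grind)
      exact ((hQ _).1 (pt.ends u hu).2).2 (sqf_mem_of_subset (by grind) hbJ)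
    · exact hbI (hII' _ ((hQ _).1 (hu1 ▸ (pt.ends u hu).1)).1)
  · intro hbJ a ha hmem
    rw [hX2] at hbJ
    have hzb : {0, i, j} ∈ sqfPoset K n I J := ⟨h0I _ (by simp), hbJ⟩
    have hac := pt.le _ hmem
    obtain rfl : a = {i, j} := by
      rcases eq_pair_of_subset_triple hac ha.1.ge with h | h | h | h
      · have := pt.disj _ hmem p hp {t, i} h.subset (by grind) hp1.subset (by grind)
        grind
      · have := pt.disj _ hmem q hq {t, j} h.subset (by grind) hq1.subset (by grind)
        grind
      · exact h
      · exact absurd ha.1 (by dsimp at h; omega)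
    obtain ⟨u, hu, hu1, hu2⟩ := exists_cover_of_interval_mem hQP pt h3 hno hz hztQ hext
      h0t h0i h0j hit.symm hjt.symm hij hbot2 ⟨h0I _ (by simp), hi3⟩ htiP hzb hmem
    rw [Finset.pair_comm i j] at hmem hzb hbot2
    obtain ⟨v, hv, hv1, hv2⟩ := exists_cover_of_interval_mem hQP pt h3 hno hz hztQ hext
      h0t h0j h0i hjt.symm hit.symm hij.symm hbot2 ⟨h0I _ (by simp), hj3⟩ htjP hzb hmem
    rw [Finset.pair_comm j i] at hv2
    have huv := pt.disj u hu v hv {0, i, j} (hu1.subset.trans (by simp)) hu2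
      (hv1.subset.trans (by simp)) hv2
    have hj0i : j ∈ ({0, i} : Finset (Fin n)) := by simp [← hv1, ← huv, hu1]
    simp [h0j.symm, hij.symm] at hj0i
end

section
/- Let K be a field, S = K[x_1,…,x_n], and let J ⊆ I be squarefree monomial ideals of S. If a squarefree monomial u of degree k lies in I \ J and every squarefree monomial of degree k+1 that is a multiple of u lies in J, then depth_S I/J ≤ k. -/
open MvPolynomial

open scoped Pointwise in
/-- If `x` is regular on a finite module `M` and `p` is an associated prime of `M` such that `p` and
`x` lie in a common prime `m`, then `M / xM` has an associated prime inside `m` strictly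
above `p`. -/
theorem exists_lt_mem_associatedPrimes_quotSMulTop {R M : Type*} [CommRing R] [IsNoetherianRing R]
    [AddCommGroup M] [Module R M] [Module.Finite R M] {m p : Ideal R} [m.IsPrime]
    (hp : p ∈ associatedPrimes R M) (hpm : p ≤ m) {x : R} (hxm : x ∈ m) (hx : IsSMulRegular M x) :
    ∃ q ∈ associatedPrimes R (QuotSMulTop x M), p < q ∧ q ≤ m := by
  obtain ⟨hprime, y, hy⟩ := isAssociatedPrime_iff.mp hp
  have mem_p (r : R) : r ∈ p ↔ r • y = 0 := by
    rw [hy, Submodule.mem_colon_singleton, Submodule.mem_bot]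
  have hxp : x ∉ p := fun h ↦ hprime.ne_top <| (Ideal.eq_top_iff_one p).mpr <| by
    rw [mem_p, one_smul]
    exact hx (by simpa using (mem_p x).mp h)
  let N : Submodule R M := Submodule.torsionBySet R M p
  have mem_N (z : M) : z ∈ N ↔ ∀ r ∈ p, r • z = 0 := by
    simp [N, Submodule.mem_torsionBySet_iff]
  have hyN : y ∈ N := (mem_N y).mpr fun r hr ↦ (mem_p r).mp hr
  let N' : Submodule R (QuotSMulTop x M) := N.map (Submodule.mkQ _)
  have hann : p ⊔ Ideal.span {x} ≤ Module.annihilator R N' := by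
    have smul_mk (r : R) (hr : ∀ z ∈ N, r • z ∈ x • (⊤ : Submodule R M)) :
        r ∈ Module.annihilator R N' := by
      refine Submodule.mem_annihilator.mpr ?_
      rintro _ ⟨z, hz, rfl⟩
      rw [← map_smul, Submodule.mkQ_apply, Submodule.Quotient.mk_eq_zero]
      exact hr z hz
    refine sup_le (fun r hr ↦ smul_mk r fun z hz ↦ ?_) ?_
    · simp [(mem_N z).mp hz r hr]
    · rw [Ideal.span_singleton_le_iff_mem]
      exact smul_mk x fun z _ ↦ Submodule.smul_mem_pointwise_smul z x ⊤ trivial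
  have hannm : Module.annihilator R N' ≤ m := by
    intro s hs
    have hrange : LinearMap.range (LinearMap.lsmul R N s) ≤ Ideal.span {x} • ⊤ := by
      rintro _ ⟨⟨z, hz⟩, rfl⟩
      have hsz := Submodule.mem_annihilator.mp hs _ (Submodule.mem_map_of_mem hz)
      rw [← map_smul, Submodule.mkQ_apply, Submodule.Quotient.mk_eq_zero] at hsz
      obtain ⟨w, -, hw⟩ := hsz
      replace hw : x • w = s • z := hw
      have hwN : w ∈ N := (mem_N w).mpr fun r hr ↦ hx <| by
        change x • r • w = x • 0
        rw [smul_comm, hw, smul_comm, (mem_N z).mp hz r hr, smul_zero, smul_zero]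
      have : LinearMap.lsmul R N s ⟨z, hz⟩ = x • (⟨w, hwN⟩ : N) := Subtype.ext hw.symm
      rw [this]
      exact Submodule.smul_mem_smul (Ideal.mem_span_singleton_self x) trivial
    obtain ⟨f, hf, -, hcoeff, hzero⟩ :=
      LinearMap.exists_monic_and_natDegree_eq_and_coeff_mem_pow_and_aeval_eq_zero R
        (LinearMap.lsmul R N s) (Ideal.span {x}) hrange
    have hfs : f.eval s ∈ m := hpm <| (mem_p _).mpr <| by
      have h := congrArg (fun g : Module.End R N ↦ (g ⟨y, hyN⟩ : M)) hzero
      have hs : LinearMap.lsmul R N s = algebraMap R (Module.End R N) s := rfl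
      rw [hs, Polynomial.aeval_algebraMap_apply] at h
      simpa using h
    rw [Polynomial.eval_eq_sum_range, Finset.sum_range_succ, hf.coeff_natDegree, one_mul] at hfs
    refine Ideal.IsPrime.mem_of_pow_mem ‹_› _ ((Submodule.add_mem_iff_right _ ?_).mp hfs)
    refine Ideal.sum_mem _ fun i hi ↦ Ideal.mul_mem_right _ _ ?_
    exact ((Ideal.span_singleton_le_iff_mem m).mpr hxm)
      (Ideal.pow_le_self (Nat.sub_ne_zero_of_lt (Finset.mem_range.mp hi)) (hcoeff i))
  obtain ⟨q, hq, hqm⟩ := Ideal.exists_minimalPrimes_le hannm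
  have hle := hann.trans hq.1.2
  refine ⟨q, ?_, ?_, hqm⟩
  · exact IsAssociatedPrime.map_of_injective N'.subtype
      (Module.associatedPrimes.minimalPrimes_annihilator_subset_associatedPrimes R N' hq)
      N'.injective_subtype
  · refine lt_of_le_of_ne (le_sup_left.trans hle) ?_
    rintro rfl
    exact hxp (hle (Ideal.mem_sup_right (Ideal.mem_span_singleton_self x)))

/-- A weakly regular sequence inside a prime `m` is no longer than the dimension of `R / p`, for
every associated prime `p ≤ m`. -/
theorem RingTheory.Sequence.IsWeaklyRegular.length_le_ringKrullDim_quotient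
    {R M : Type*} [CommRing R] [IsNoetherianRing R] [AddCommGroup M] [Module R M]
    [Module.Finite R M] {m p : Ideal R} [m.IsPrime] (hp : p ∈ associatedPrimes R M) (hpm : p ≤ m)
    {rs : List R} (hrs : ∀ r ∈ rs, r ∈ m) (h : IsWeaklyRegular M rs) :
    (rs.length : WithBot ℕ∞) ≤ ringKrullDim (R ⧸ p) := by
  have hIci : PrimeSpectrum.zeroLocus (p : Set R) = Set.Ici ⟨p, hp.1⟩ := rfl
  rw [ringKrullDim_quotient, hIci, ← Order.coheight_eq_krullDim_Ici]
  norm_cast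
  clear hIci
  induction rs generalizing M p with
  | nil => simp
  | cons x rs ih =>
    rw [isWeaklyRegular_cons_iff] at h
    obtain ⟨q, hq, hpq, hqm⟩ := exists_lt_mem_associatedPrimes_quotSMulTop hp hpm
      (hrs x List.mem_cons_self) h.1
    have hlt : (⟨p, hp.1⟩ : PrimeSpectrum R) < ⟨q, hq.1⟩ := hpq
    refine le_trans ?_ (Order.coheight_add_one_le hlt)
    rw [List.length_cons, Nat.cast_add_one]
    gcongr
    exact ih hq hqm (fun r hr ↦ hrs r (List.mem_cons_of_mem x hr)) h.2

theorem sqf_eq_monomial (K : Type*) [Field K] (n : ℕ) (T : Finset (Fin n)) :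
    sqf K n T = monomial (∑ i ∈ T, Finsupp.single i 1) 1 := by
  rw [sqf, monomial_sum_one]
  rfl

theorem sum_single_one_apply {n : ℕ} (T : Finset (Fin n)) (i : Fin n) :
    (∑ j ∈ T, Finsupp.single j 1 : Fin n →₀ ℕ) i = if i ∈ T then 1 else 0 := by
  simp [Finsupp.finsetSum_apply, Finsupp.single_apply]

theorem mem_span_sqf_iff {K : Type*} [Field K] {n : ℕ} {G : Set (Finset (Fin n))}
    {g : MvPolynomial (Fin n) K} :
    g ∈ Ideal.span (sqf K n '' G) ↔
      ∀ d ∈ g.support, ∃ T ∈ G, ∑ i ∈ T, Finsupp.single i 1 ≤ d := by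
  have : sqf K n '' G = (fun d ↦ monomial d (1 : K)) ''
      ((fun T : Finset (Fin n) ↦ ∑ i ∈ T, Finsupp.single i 1) '' G) := by
    rw [Set.image_image]
    exact Set.image_congr fun T _ ↦ sqf_eq_monomial K n T
  rw [this, mem_ideal_span_monomial_image]
  simp

theorem mul_sqf_mem_iff {K : Type*} [Field K] {n : ℕ} {J : Ideal (MvPolynomial (Fin n) K)}
    (hJ : ∃ G : Set (Finset (Fin n)), J = Ideal.span (sqf K n '' G)) {U : Finset (Fin n)}
    (hUJ : sqf K n U ∉ J) (hmult : ∀ i ∉ U, sqf K n (insert i U) ∈ J)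
    (g : MvPolynomial (Fin n) K) :
    g * sqf K n U ∈ J ↔ g ∈ Ideal.span (X '' {i | i ∉ U}) := by
  refine ⟨fun h ↦ ?_, fun h ↦ ?_⟩
  · obtain ⟨G, rfl⟩ := hJ
    rw [mem_ideal_span_X_image]
    intro d hd
    by_contra! hdU
    have hmem : d + ∑ i ∈ U, Finsupp.single i 1 ∈ (g * sqf K n U).support := by
      rw [mem_support_iff, sqf_eq_monomial, coeff_mul_monomial, mul_one]
      exact mem_support_iff.mp hd
    obtain ⟨T, hT, hTd⟩ := mem_span_sqf_iff.mp h _ hmem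
    have hTU : T ⊆ U := by
      intro i hi
      by_contra hiU
      have := hTd i
      rw [Finsupp.add_apply, sum_single_one_apply, sum_single_one_apply, hdU i hiU, if_pos hi,
        if_neg hiU] at this
      omega
    refine hUJ (Ideal.mem_of_dvd _ ?_ (Ideal.subset_span ⟨T, hT, rfl⟩))
    exact Finset.prod_dvd_prod_of_subset _ _ _ hTU
  · have hle : Ideal.span (X '' {i | i ∉ U}) ≤ J.colon {sqf K n U} := by
      rw [Ideal.span_le]
      rintro _ ⟨i, hi, rfl⟩
      rw [SetLike.mem_coe, Submodule.mem_colon_singleton, smul_eq_mul]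
      have := hmult i hi
      rwa [sqf, Finset.prod_insert hi] at this
    exact Submodule.mem_colon_singleton.mp (hle h)

theorem ker_killCompl_subtype {K : Type*} [Field K] {n : ℕ} (U : Finset (Fin n)) :
    RingHom.ker (killCompl (R := K) (Subtype.val_injective (p := (· ∈ U)))) =
      Ideal.span (X '' {i | i ∉ U}) := by
  ext g
  rw [RingHom.mem_ker, mem_ideal_span_X_image]
  refine ⟨fun h d hd ↦ ?_, fun h ↦ ?_⟩
  · by_contra! hdU
    have hsub : (d.support : Set (Fin n)) ⊆ Set.range (Subtype.val (p := (· ∈ U))) := by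
      intro i hi
      by_contra hiU
      exact Finsupp.mem_support_iff.mp hi (hdU i (by simpa using hiU))
    apply mem_support_iff.mp hd
    rw [← Finsupp.mapDomain_comapDomain _ Subtype.val_injective d hsub,
      ← coeff_killCompl Subtype.val_injective, h, coeff_zero]
  · ext d
    rw [coeff_killCompl, coeff_zero]
    by_contra hne
    obtain ⟨i, hiU, hi⟩ := h _ (mem_support_iff.mpr hne)
    exact hi (Finsupp.mapDomain_of_notMem_range _ _ (by simpa using hiU))

/-- **Lemma 1.5.** -/
theorem stmt7 (n : ℕ) (K : Type*) [Field K]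
    (I J : Ideal (MvPolynomial (Fin n) K))
    (hI : ∃ G : Set (Finset (Fin n)), I = Ideal.span (sqf K n '' G))
    (hJ : ∃ G : Set (Finset (Fin n)), J = Ideal.span (sqf K n '' G))
    (hJI : J ≤ I)
    (k : ℕ) (U : Finset (Fin n)) (hUcard : U.card = k)
    (hUI : sqf K n U ∈ I) (hUJ : sqf K n U ∉ J)
    (hmult : ∀ T : Finset (Fin n), U ⊆ T → T.card = k + 1 → sqf K n T ∈ J) :
    mdepth K n I J ≤ k := by
  refine csSup_le' ?_
  rintro _ ⟨rs, rfl, hrs, hreg⟩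
  have hspan : Ideal.span (Set.range (X : Fin n → MvPolynomial (Fin n) K)) =
      RingHom.ker (constantCoeff (σ := Fin n) (R := K)) := by
    ext g
    rw [← Set.image_univ, mem_ideal_span_X_image, RingHom.mem_ker, constantCoeff_eq]
    refine ⟨fun h ↦ ?_, fun h d hd ↦ ?_⟩
    · by_contra hne
      simpa using h 0 (mem_support_iff.mpr hne)
    · by_contra! hzero
      have : d = 0 := Finsupp.ext fun i ↦ hzero i trivial
      exact mem_support_iff.mp hd (this ▸ h)
  let φ := killCompl (R := K) (Subtype.val_injective (p := (· ∈ U)))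
  have hφ : Function.Surjective φ := fun g ↦ ⟨_, killCompl_rename_app Subtype.val_injective g⟩
  have hker := ker_killCompl_subtype (K := K) U
  have hprime := RingHom.ker_isPrime φ
  have hass : RingHom.ker φ ∈ associatedPrimes (MvPolynomial (Fin n) K) (quotMod K n I J) := by
    refine isAssociatedPrime_iff.mpr ⟨hprime, Submodule.Quotient.mk ⟨sqf K n U, hUI⟩, ?_⟩
    ext g
    rw [Submodule.mem_colon_singleton, Submodule.mem_bot, ← Submodule.Quotient.mk_smul,
      Submodule.Quotient.mk_eq_zero, hker, ← mul_sqf_mem_iff hJ hUJ fun i hi ↦ hmult _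
        (Finset.subset_insert i U) (by rw [Finset.card_insert_of_notMem hi, hUcard])]
    rfl
  have hle : RingHom.ker φ ≤ RingHom.ker (constantCoeff (σ := Fin n) (R := K)) := by
    rw [hker, ← hspan]
    exact Ideal.span_mono (Set.image_subset_range _ _)
  have := RingHom.ker_isPrime (constantCoeff (σ := Fin n) (R := K))
  have hlen := hreg.toIsWeaklyRegular.length_le_ringKrullDim_quotient hass hle
    (fun r hr ↦ hspan ▸ hrs r hr)
  rw [ringKrullDim_eq_of_ringEquiv (Ideal.quotientKerAlgEquivOfSurjective hφ).toRingEquiv,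
    MvPolynomial.ringKrullDim_of_isNoetherianRing, ringKrullDim_eq_zero_of_field, zero_add,
    Nat.card_eq_fintype_card, Fintype.card_coe, hUcard] at hlen
  exact_mod_cast hlen
end

section
/- Let K be a field, S = K[x_1,…,x_n], let I = (x_1,…,x_r) for some 1 ≤ r < n, and let J ⊂ I be a squarefree monomial ideal generated in degrees ≥ 2. Let B be the set of squarefree monomials of degree 2 in I \ J. If depth_S I/(J + ({b ∈ B : x_j divides b})) = 1 for some r < j ≤ n (where ({b ∈ B : x_j divides b}) denotes the ideal generated by the monomials of B divisible by x_j), then depth_S I/J ≤ 2. -/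
open MvPolynomial

section Koszul

variable {R ι M N : Type*} [CommRing R] [AddCommGroup M] [Module R M] [AddCommGroup N] [Module R N]

/-- Vanishing of the zeroth Koszul cohomology of `M` with respect to `x`. -/
def KoszulZeroVanishes (x : ι → R) (M : Type*) [AddCommGroup M] [Module R M] : Prop :=
  ∀ m : M, (∀ i, x i • m = 0) → m = 0

/-- Vanishing of the first Koszul cohomology of `M` with respect to `x`. -/
def KoszulOneVanishes (x : ι → R) (M : Type*) [AddCommGroup M] [Module R M] : Prop :=
  ∀ m : ι → M, (∀ i k, x i • m k = x k • m i) → ∃ y : M, ∀ i, m i = x i • y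

/-- Vanishing of the second Koszul cohomology of `M` with respect to `x`. -/
def KoszulTwoVanishes (x : ι → R) (M : Type*) [AddCommGroup M] [Module R M] : Prop :=
  ∀ m : ι → ι → M, (∀ i k l, x i • m k l - x k • m i l + x l • m i k = 0) →
    ∃ y : ι → M, ∀ i k, m i k = x i • y k - x k • y i

theorem QuotSMulTop.mk_eq_zero_iff {a : R} {m : M} :
    (Submodule.Quotient.mk m : QuotSMulTop a M) = 0 ↔ ∃ y : M, a • y = m := by
  rw [Submodule.Quotient.mk_eq_zero, Submodule.mem_smul_pointwise_iff_exists]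
  simp

theorem IsSMulRegular.koszulZeroVanishes [Fintype ι] {x : ι → R} {a : R}
    (ha : IsSMulRegular M a) (hax : a ∈ Ideal.span (Set.range x)) :
    KoszulZeroVanishes x M := by
  intro m hm
  obtain ⟨c, rfl⟩ := Ideal.mem_span_range_iff_exists_fun.1 hax
  refine ha ?_
  simp [Finset.sum_smul, mul_smul, hm]

theorem IsSMulRegular.koszulOneVanishes [Fintype ι] {x : ι → R} {a : R}
    (ha : IsSMulRegular M a) (hax : a ∈ Ideal.span (Set.range x))
    (h : KoszulZeroVanishes x (QuotSMulTop a M)) : KoszulOneVanishes x M := by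
  intro m hm
  obtain ⟨c, hc⟩ := Ideal.mem_span_range_iff_exists_fun.1 hax
  have key (k : ι) : x k • ∑ i, c i • m i = a • m k := by
    rw [← hc, Finset.sum_smul, Finset.smul_sum]
    refine Finset.sum_congr rfl fun i _ => ?_
    rw [mul_smul, hm i k, smul_comm]
  have hzero : (Submodule.Quotient.mk (∑ i, c i • m i) : QuotSMulTop a M) = 0 := by
    refine h _ fun k => ?_
    rw [← Submodule.Quotient.mk_smul, QuotSMulTop.mk_eq_zero_iff]
    exact ⟨m k, (key k).symm⟩
  obtain ⟨y, hy⟩ := QuotSMulTop.mk_eq_zero_iff.1 hzero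
  refine ⟨y, fun k => ha ?_⟩
  change a • m k = a • x k • y
  rw [← key, ← hy, smul_comm]

theorem IsSMulRegular.koszulTwoVanishes [Fintype ι] {x : ι → R} {a : R}
    (ha : IsSMulRegular M a) (hax : a ∈ Ideal.span (Set.range x))
    (h : KoszulOneVanishes x (QuotSMulTop a M)) : KoszulTwoVanishes x M := by
  intro m hm
  obtain ⟨c, hc⟩ := Ideal.mem_span_range_iff_exists_fun.1 hax
  have key (k l : ι) : x k • ∑ i, c i • m i l - x l • ∑ i, c i • m i k = a • m k l := by
    rw [← hc, Finset.sum_smul, Finset.smul_sum, Finset.smul_sum, ← Finset.sum_sub_distrib]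
    refine Finset.sum_congr rfl fun i _ => ?_
    linear_combination (norm := module) (- c i) • hm i k l
  obtain ⟨y, hy⟩ := h (fun k => Submodule.Quotient.mk (∑ i, c i • m i k)) fun k l => by
    rw [← sub_eq_zero, ← Submodule.Quotient.mk_smul, ← Submodule.Quotient.mk_smul,
      ← Submodule.Quotient.mk_sub, QuotSMulTop.mk_eq_zero_iff]
    exact ⟨m k l, (key k l).symm⟩
  obtain ⟨y, rfl⟩ := Submodule.Quotient.mk_surjective _ y
  have hp (k : ι) : ∃ p : M, a • p = (∑ i, c i • m i k) - x k • y := by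
    rw [← QuotSMulTop.mk_eq_zero_iff, Submodule.Quotient.mk_sub, Submodule.Quotient.mk_smul,
      sub_eq_zero]
    exact hy k
  choose p hp using hp
  refine ⟨p, fun k l => ha ?_⟩
  change a • m k l = a • (x k • p l - x l • p k)
  rw [← key]
  linear_combination (norm := module) x l • hp k - x k • hp l

theorem KoszulOneVanishes.quotSMulTop {x : ι → R} {a : R} (ha : IsSMulRegular M a)
    (h : KoszulOneVanishes x M) (hzero : KoszulZeroVanishes x M) :
    KoszulZeroVanishes x (QuotSMulTop a M) := by
  intro y hy
  obtain ⟨y, rfl⟩ := Submodule.Quotient.mk_surjective _ y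
  have hz (i : ι) : ∃ z : M, a • z = x i • y := by
    rw [← QuotSMulTop.mk_eq_zero_iff]
    exact hy i
  choose z hz using hz
  obtain ⟨w, hw⟩ := h z fun i k => ha <| by
    change a • x i • z k = a • x k • z i
    rw [smul_comm, hz, smul_comm a, hz, smul_comm]
  refine QuotSMulTop.mk_eq_zero_iff.2 ⟨w, ?_⟩
  rw [← sub_eq_zero]
  refine hzero _ fun i => ?_
  rw [smul_sub, ← hz, hw, smul_comm, sub_self]

theorem KoszulZeroVanishes.exists_isSMulRegular [IsNoetherianRing R] [Module.Finite R M]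
    {x : ι → R} (h : KoszulZeroVanishes x M) :
    ∃ a ∈ Ideal.span (Set.range x), IsSMulRegular M a := by
  by_contra! hcon
  have hsub : (Ideal.span (Set.range x) : Set R) ⊆ ⋃ p ∈ associatedPrimes R M, p := by
    rw [biUnion_associatedPrimes_eq_zero_divisors]
    intro a ha
    have := hcon a ha
    rw [isSMulRegular_iff_right_eq_zero_of_smul] at this
    push Not at this
    obtain ⟨m, hm, hm0⟩ := this
    exact ⟨m, hm0, hm⟩
  obtain ⟨p, hp, hle⟩ := (Ideal.subset_union_prime_finite (associatedPrimes.finite R M)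
    (f := id) ⊥ ⊥ fun p hp _ _ => hp.isPrime).1 hsub
  obtain ⟨hprime, m, rfl⟩ := isAssociatedPrime_iff.1 hp
  have hm : m = 0 := h m fun i => by
    simpa using hle (Ideal.subset_span ⟨i, rfl⟩)
  exact hprime.ne_top (by simp [hm])

theorem KoszulOneVanishes.exists_isWeaklyRegular [IsNoetherianRing R] [Module.Finite R M]
    {x : ι → R} (h : KoszulOneVanishes x M) (hzero : KoszulZeroVanishes x M) :
    ∃ a ∈ Ideal.span (Set.range x), ∃ b ∈ Ideal.span (Set.range x),
      RingTheory.Sequence.IsWeaklyRegular M [a, b] := by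
  obtain ⟨a, ha, hareg⟩ := hzero.exists_isSMulRegular
  obtain ⟨b, hb, hbreg⟩ := (h.quotSMulTop hareg hzero).exists_isSMulRegular
  exact ⟨a, ha, b, hb, .cons hareg (.cons hbreg (.nil R _))⟩

theorem RingTheory.Sequence.IsWeaklyRegular.koszul_vanishing [Fintype ι] {x : ι → R}
    {rs : List R} (hrs : ∀ a ∈ rs, a ∈ Ideal.span (Set.range x)) (hlen : 3 ≤ rs.length)
    (h : IsWeaklyRegular M rs) : KoszulOneVanishes x M ∧ KoszulTwoVanishes x M := by
  obtain ⟨a, b, c, l, rfl⟩ : ∃ a b c l, rs = a :: b :: c :: l := by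
    match rs, hlen with
    | a :: b :: c :: l, _ => exact ⟨a, b, c, l, rfl⟩
  simp only [isWeaklyRegular_cons_iff] at h
  obtain ⟨ha, hb, hc, -⟩ := h
  have hax := hrs a (by simp)
  have hbx := hrs b (by simp)
  have hcx := hrs c (by simp)
  exact ⟨ha.koszulOneVanishes hax (hb.koszulZeroVanishes hbx),
    ha.koszulTwoVanishes hax (hb.koszulOneVanishes hbx (hc.koszulZeroVanishes hcx))⟩

variable {φ : R →+* R} {x : ι → R} {j : ι}

/-- If `N` is a quotient of `M` killed by `x j`, with a section linear over the subring generated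
by the other `x i`, then a class of degree one in `M` restricts to one of degree zero in `N`. -/
theorem KoszulOneVanishes.of_section (p : M →ₗ[R] N) (s : N →ₛₗ[φ] M) (hps : ∀ a, p (s a) = a)
    (hφ : ∀ i, i ≠ j → φ (x i) = x i) (hj : ∀ a : N, x j • a = 0)
    (h : KoszulOneVanishes x M) : KoszulZeroVanishes x N := by
  classical
  intro a ha
  have hs (i : ι) (hi : i ≠ j) : x i • s a = 0 := by
    rw [← hφ i hi, ← map_smulₛₗ, ha, map_zero]
  obtain ⟨y, hy⟩ := h (Pi.single j (s a)) fun i k => by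
    by_cases hi : i = j <;> by_cases hk : k = j <;> simp [*]
  rw [← hps a, ← Pi.single_eq_same (M := fun _ => M) j (s a), hy, map_smul, hj]

/-- The analogue of `KoszulOneVanishes.of_section` one degree higher. -/
theorem KoszulTwoVanishes.of_section (p : M →ₗ[R] N) (s : N →ₛₗ[φ] M) (hps : ∀ a, p (s a) = a)
    (hφ : ∀ i, i ≠ j → φ (x i) = x i) (hj : ∀ a : N, x j • a = 0)
    (hzero : KoszulZeroVanishes x N) (h : KoszulTwoVanishes x M) : KoszulOneVanishes x N := by
  classical
  intro a ha
  have haj : a j = 0 := hzero _ fun i => by rw [ha, hj]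
  have hs (i k : ι) (hi : i ≠ j) (hk : k ≠ j) : x i • s (a k) = x k • s (a i) := by
    rw [← hφ i hi, ← hφ k hk, ← map_smulₛₗ, ← map_smulₛₗ, ha]
  obtain ⟨y, hy⟩ := h
    (fun i k => (if i = j then s (a k) else 0) - if k = j then s (a i) else 0) fun i k l => by
      by_cases hi : i = j <;> by_cases hk : k = j <;> by_cases hl : l = j <;>
        simp [*]
  refine ⟨- p (y j), fun i => ?_⟩
  have := congrArg p (hy j i)
  by_cases hi : i = j
  · simp [hi, haj, hj]
  · simpa [hi, hj, hps] using this

end Koszul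

section Squarefree

variable {K : Type*} [Field K] {n : ℕ}

theorem sqf_mem_idealOfVars_pow (T : Finset (Fin n)) :
    sqf K n T ∈ idealOfVars (Fin n) K ^ T.card := by
  rw [sqf, ← Finset.prod_const]
  exact Ideal.prod_mem_prod fun i _ => Ideal.subset_span ⟨i, rfl⟩

theorem span_sqf_le_idealOfVars_sq {G : Set (Finset (Fin n))} (hG : ∀ T ∈ G, 2 ≤ T.card) :
    Ideal.span (sqf K n '' G) ≤ idealOfVars (Fin n) K ^ 2 := by
  rw [Ideal.span_le]
  rintro _ ⟨T, hT, rfl⟩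
  exact Ideal.pow_le_pow_right (hG T hT) (sqf_mem_idealOfVars_pow T)

theorem X_notMem_idealOfVars_sq (i : Fin n) :
    (X i : MvPolynomial (Fin n) K) ∉ idealOfVars (Fin n) K ^ 2 := by
  rw [X, monomial_mem_pow_idealOfVars_iff _ _ one_ne_zero]
  simp

variable (K) in
/-- The endomorphism of `K[x_0,…,x_{n-1}]` sending `x_j` to `0` and fixing the other variables. -/
noncomputable def killVar (j : Fin n) : MvPolynomial (Fin n) K →ₐ[K] MvPolynomial (Fin n) K :=
  aeval (Function.update X j 0)

theorem killVar_X_self (j : Fin n) : killVar K j (X j) = 0 := by simp [killVar]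

theorem killVar_X_of_ne {i j : Fin n} (h : i ≠ j) : killVar K j (X i) = X i := by
  simp [killVar, h]

theorem killVar_sqf_of_mem {j : Fin n} {T : Finset (Fin n)} (h : j ∈ T) :
    killVar K j (sqf K n T) = 0 := by
  rw [sqf, map_prod]
  exact Finset.prod_eq_zero h (killVar_X_self j)

theorem killVar_sqf_of_notMem {j : Fin n} {T : Finset (Fin n)} (h : j ∉ T) :
    killVar K j (sqf K n T) = sqf K n T := by
  rw [sqf, map_prod]
  exact Finset.prod_congr rfl fun i hi => killVar_X_of_ne (ne_of_mem_of_not_mem hi h)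

theorem span_sqf_le_comap_killVar (j : Fin n) (G : Set (Finset (Fin n))) :
    Ideal.span (sqf K n '' G) ≤ (Ideal.span (sqf K n '' G)).comap (killVar K j) := by
  rw [Ideal.span_le]
  rintro _ ⟨T, hT, rfl⟩
  rw [SetLike.mem_coe, Ideal.mem_comap]
  by_cases h : j ∈ T
  · simp [killVar_sqf_of_mem h]
  · rw [killVar_sqf_of_notMem h]
    exact Ideal.subset_span ⟨T, hT, rfl⟩

theorem span_X_le_comap_killVar {j : Fin n} {A : Set (Fin n)} (hj : j ∉ A) :
    Ideal.span (X '' A) ≤ (Ideal.span (X '' A)).comap (killVar K j) := by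
  rw [Ideal.span_le]
  rintro _ ⟨i, hi, rfl⟩
  rw [SetLike.mem_coe, Ideal.mem_comap, killVar_X_of_ne (ne_of_mem_of_not_mem hi hj)]
  exact Ideal.subset_span ⟨i, hi, rfl⟩

theorem sub_killVar_mem_span (j : Fin n) (f : MvPolynomial (Fin n) K) :
    f - killVar K j f ∈ Ideal.span {(X j : MvPolynomial (Fin n) K)} := by
  induction f using MvPolynomial.induction_on with
  | C a => simp [killVar]
  | add p q hp hq =>
    rw [map_add, add_sub_add_comm]
    exact add_mem hp hq
  | mul_X p i hp =>
    rw [map_mul]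
    by_cases h : i = j
    · subst h
      rw [killVar_X_self, mul_zero, sub_zero]
      exact Ideal.mul_mem_left _ _ (Ideal.subset_span rfl)
    · rw [killVar_X_of_ne h, ← sub_mul]
      exact Ideal.mul_mem_right _ _ hp

theorem sub_killVar_mem_span_mul {j : Fin n} {A : Set (Fin n)} (hj : j ∉ A)
    {f : MvPolynomial (Fin n) K} (hf : f ∈ Ideal.span (X '' A)) :
    f - killVar K j f ∈ Ideal.span {(X j : MvPolynomial (Fin n) K)} * Ideal.span (X '' A) := by
  induction hf using Submodule.span_induction with
  | mem f hf =>
    obtain ⟨i, hi, rfl⟩ := hf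
    rw [killVar_X_of_ne (ne_of_mem_of_not_mem hi hj), sub_self]
    exact zero_mem _
  | zero => simp
  | add p q _ _ hp hq =>
    rw [map_add, add_sub_add_comm]
    exact add_mem hp hq
  | smul a f hf ih =>
    have : a • f - killVar K j (a • f)
        = (a - killVar K j a) * f + killVar K j a * (f - killVar K j f) := by
      rw [smul_eq_mul, map_mul]
      ring
    rw [this]
    exact add_mem (Ideal.mul_mem_mul (sub_killVar_mem_span j a) hf) (Ideal.mul_mem_left _ _ ih)

theorem le_mdepth {I J : Ideal (MvPolynomial (Fin n) K)} (h : mdepth K n I J ≠ 0)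
    {rs : List (MvPolynomial (Fin n) K)}
    (hrs : ∀ f ∈ rs, f ∈ Ideal.span (Set.range (X : Fin n → MvPolynomial (Fin n) K)))
    (hreg : RingTheory.Sequence.IsRegular (quotMod K n I J) rs) :
    rs.length ≤ mdepth K n I J := by
  refine le_csSup ?_ ⟨rs, rfl, hrs, hreg⟩
  by_contra hb
  exact h (Nat.sSup_of_not_bddAbove hb)

theorem exists_isRegular_of_mdepth_ne_zero {I J : Ideal (MvPolynomial (Fin n) K)}
    (h : mdepth K n I J ≠ 0) :
    ∃ rs : List (MvPolynomial (Fin n) K), rs.length = mdepth K n I J ∧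
      (∀ f ∈ rs, f ∈ Ideal.span (Set.range (X : Fin n → MvPolynomial (Fin n) K))) ∧
      RingTheory.Sequence.IsRegular (quotMod K n I J) rs := by
  unfold mdepth at h ⊢
  generalize hS : {k | ∃ rs : List (MvPolynomial (Fin n) K), rs.length = k ∧ _} = S at h ⊢
  have hmem : sSup S ∈ S := by
    refine Nat.sSup_mem (Set.nonempty_iff_ne_empty.2 fun he => h ?_) (by_contra fun hb => h ?_)
    · rw [he, csSup_empty, Nat.bot_eq_zero]
    · exact Nat.sSup_of_not_bddAbove hb
  rwa [← hS, Set.mem_ofPred_eq, hS] at hmem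

theorem quotMod_top_ne_smul {I J : Ideal (MvPolynomial (Fin n) K)} {i : Fin n}
    (hi : (X i : MvPolynomial (Fin n) K) ∈ I) (hI : I ≤ idealOfVars (Fin n) K)
    (hJ : J ≤ idealOfVars (Fin n) K ^ 2) {a : Ideal (MvPolynomial (Fin n) K)}
    (ha : a ≤ idealOfVars (Fin n) K) :
    (⊤ : Submodule (MvPolynomial (Fin n) K) (quotMod K n I J)) ≠ a • ⊤ := by
  intro h
  have hmem (y : quotMod K n I J) (hy : y ∈ a • (⊤ : Submodule (MvPolynomial (Fin n) K) (quotMod K n I J))) :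
      ∀ f : I, Submodule.Quotient.mk f = y → (f : MvPolynomial (Fin n) K) ∈
        idealOfVars (Fin n) K ^ 2 := by
    induction hy using Submodule.smul_induction_on' with
    | smul c hc y _ =>
      intro f hf
      obtain ⟨g, rfl⟩ := Submodule.Quotient.mk_surjective _ y
      rw [← Submodule.Quotient.mk_smul, Submodule.Quotient.eq] at hf
      have hcg : c * (g : MvPolynomial (Fin n) K) ∈ idealOfVars (Fin n) K ^ 2 := by
        rw [pow_two]
        exact Ideal.mul_mem_mul (ha hc) (hI g.2)
      have := add_mem (hJ hf) hcg
      simpa using this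
    | add y _ z _ hy hz =>
      intro f hf
      obtain ⟨g, rfl⟩ := Submodule.Quotient.mk_surjective _ y
      obtain ⟨g', rfl⟩ := Submodule.Quotient.mk_surjective _ z
      rw [← Submodule.Quotient.mk_add, Submodule.Quotient.eq] at hf
      have := add_mem (hJ hf) (add_mem (hy g rfl) (hz g' rfl))
      simpa using this
  exact X_notMem_idealOfVars_sq i (hmem _ (h ▸ Submodule.mem_top) ⟨X i, hi⟩ rfl)

/-- Depth drops by at most one, from `I/J` of depth at least three, when passing to a quotient
`I/L` on which `x_j` vanishes and for which `x_j ↦ 0` induces a section of `I/J → I/L`. -/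
theorem exists_isWeaklyRegular_of_killVar {I J L : Ideal (MvPolynomial (Fin n) K)} (j : Fin n)
    (hJL : J ≤ L) (hI : I ≤ I.comap (killVar K j)) (hL : L ≤ J.comap (killVar K j))
    (hXL : ∀ f ∈ I, X j * f ∈ L) (hsub : ∀ f ∈ I, f - killVar K j f ∈ L)
    (h : 3 ≤ mdepth K n I J) :
    ∃ a ∈ Ideal.span (Set.range (X : Fin n → MvPolynomial (Fin n) K)),
      ∃ b ∈ Ideal.span (Set.range (X : Fin n → MvPolynomial (Fin n) K)),
        RingTheory.Sequence.IsWeaklyRegular (quotMod K n I L) [a, b] := by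
  obtain ⟨rs, hlen, hrs, hreg⟩ := exists_isRegular_of_mdepth_ne_zero (by omega : mdepth K n I J ≠ 0)
  obtain ⟨hone, htwo⟩ := hreg.toIsWeaklyRegular.koszul_vanishing hrs (hlen ▸ h)
  let φ : MvPolynomial (Fin n) K →+* MvPolynomial (Fin n) K := (killVar K j : _ →+* _)
  let e : I →ₛₗ[φ] I :=
    { toFun := fun f => ⟨killVar K j f, hI f.2⟩
      map_add' := fun f g => Subtype.ext (map_add (killVar K j) _ _)
      map_smul' := fun c f => Subtype.ext (map_mul (killVar K j) _ _) }
  let p : quotMod K n I J →ₗ[MvPolynomial (Fin n) K] quotMod K n I L :=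
    Submodule.mapQ _ _ LinearMap.id fun f hf => hJL hf
  let s : quotMod K n I L →ₛₗ[φ] quotMod K n I J := Submodule.mapQ _ _ e fun f hf => hL hf
  have hps (a : quotMod K n I L) : p (s a) = a := by
    obtain ⟨f, rfl⟩ := Submodule.Quotient.mk_surjective _ a
    refine ((Submodule.Quotient.eq _).2 ?_).symm
    exact hsub f f.2
  have hφ (i : Fin n) (hi : i ≠ j) : φ (X i) = X i := killVar_X_of_ne hi
  have hj (a : quotMod K n I L) : (X j : MvPolynomial (Fin n) K) • a = 0 := by
    obtain ⟨f, rfl⟩ := Submodule.Quotient.mk_surjective _ a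
    rw [← Submodule.Quotient.mk_smul, Submodule.Quotient.mk_eq_zero]
    exact hXL f f.2
  have hzero := hone.of_section p s hps hφ hj
  exact (htwo.of_section p s hps hφ hj hzero).exists_isWeaklyRegular hzero

end Squarefree

/-- **Lemma 1.1.** -/
theorem stmt10 (n : ℕ) (K : Type*) [Field K]
    (r : ℕ) (hr1 : 1 ≤ r) (hrn : r < n)
    (I J : Ideal (MvPolynomial (Fin n) K))
    (hI : I = Ideal.span (X '' {i : Fin n | (i : ℕ) < r}))
    (hJI : J < I)
    (hJ : ∃ G : Set (Finset (Fin n)), (∀ T ∈ G, 2 ≤ T.card) ∧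
      J = Ideal.span (sqf K n '' G))
    (j : Fin n) (hj : r ≤ (j : ℕ))
    (hdepth : mdepth K n I
      (J + Ideal.span (sqf K n '' {T ∈ degSet K n I J 2 | j ∈ T})) = 1) :
    mdepth K n I J ≤ 2 := by
  obtain ⟨G, hG, hJG⟩ := hJ
  by_contra! h3
  set B : Ideal (MvPolynomial (Fin n) K) :=
    Ideal.span (sqf K n '' {T ∈ degSet K n I J 2 | j ∈ T})
  have hjr : j ∉ {i : Fin n | (i : ℕ) < r} := not_lt.2 hj
  have hXI : Ideal.span {X j} * I ≤ J + B := by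
    rw [hI, Ideal.span_mul_span', Ideal.span_le]
    rintro _ ⟨_, rfl, _, ⟨i, hi, rfl⟩, rfl⟩
    have hij : j ≠ i := fun e => hjr (e ▸ hi)
    have hsq : sqf K n {j, i} = X j * X i := by rw [sqf, Finset.prod_pair hij]
    have hXi : (X i : MvPolynomial (Fin n) K) ∈ I := hI ▸ Ideal.subset_span ⟨i, hi, rfl⟩
    change X j * X i ∈ J + B
    by_cases hmem : X j * X i ∈ J
    · exact Submodule.mem_sup_left hmem
    · refine Submodule.mem_sup_right (Ideal.subset_span ⟨{j, i}, ⟨⟨?_, ?_, ?_⟩, by simp⟩, hsq⟩)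
      · exact Finset.card_pair hij
      · exact hsq ▸ Ideal.mul_mem_left _ _ hXi
      · exact hsq ▸ hmem
  obtain ⟨a, ha, b, hb, hab⟩ := exists_isWeaklyRegular_of_killVar (L := J + B) j le_sup_left
    (hI ▸ span_X_le_comap_killVar hjr)
    (sup_le (hJG ▸ span_sqf_le_comap_killVar j G) <| Ideal.span_le.2 <| by
      rintro _ ⟨T, hT, rfl⟩
      rw [SetLike.mem_coe, Ideal.mem_comap, killVar_sqf_of_mem hT.2]
      exact zero_mem _)
    (fun f hf => hXI (Ideal.mul_mem_mul (Ideal.subset_span rfl) hf))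
    (fun f hf => hXI (hI ▸ sub_killVar_mem_span_mul hjr (hI ▸ hf))) h3
  have hab_mem : ∀ f ∈ [a, b],
      f ∈ Ideal.span (Set.range (X : Fin n → MvPolynomial (Fin n) K)) := by
    simp [ha, hb]
  have hX0 : (X ⟨0, by omega⟩ : MvPolynomial (Fin n) K) ∈ I :=
    hI ▸ Ideal.subset_span ⟨⟨0, by omega⟩, hr1, rfl⟩
  have htop : (⊤ : Submodule _ (quotMod K n I (J + B))) ≠ Ideal.ofList [a, b] • ⊤ :=
    quotMod_top_ne_smul (i := ⟨0, by omega⟩) hX0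
      (hI ▸ Ideal.span_mono (Set.image_subset_range _ _))
      (sup_le (hJG ▸ span_sqf_le_idealOfVars_sq hG)
        (span_sqf_le_idealOfVars_sq fun T hT => hT.1.1.ge))
      (Ideal.span_le.2 hab_mem)
  have := le_mdepth (by omega) hab_mem ⟨hab, htop⟩
  rw [hdepth] at this
  simp at this
end
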